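/- Let T>0, α>0, and let K:[0,T)→ℝ be a càdlàg function. Then for all 0≤s<t<T one has the inversion formula K_t − K_s = (T/(T−t))^α (I_t^α K − I_s^α K) − αT^α ∫_s^t (T−u)^{−α−1}(I_u^α K − I_s^α K) du. Consequently: (1) |K_t − K_s| ≤ 2 (T/(T−t))^α sup_{u∈[s,t]} |I_u^α K − I_s^α K| for all 0≤s<t<T; (2) if the limit I_T^α K := lim_{t↑T} I_t^α K exists in ℝ, then lim_{t↑T} (T−t)^α K_t = 0. -/

import Mathlib

open MeasureTheory Filter Set

/-- A function `K : ℝ → ℝ` is càdlàg on `[0,T)`: it is right-continuous at every point of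
`[0,T)` and has left limits at every point of `(0,T)`. -/
def CadlagOn (K : ℝ → ℝ) (T : ℝ) : Prop :=
  (∀ t ∈ Set.Ico (0:ℝ) T, Filter.Tendsto K (nhdsWithin t (Set.Ici t)) (nhds (K t))) ∧
  (∀ t ∈ Set.Ioo (0:ℝ) T, ∃ l : ℝ, Filter.Tendsto K (nhdsWithin t (Set.Iio t)) (nhds l))

/-- The Riemann–Liouville type operator
`I_t^α K := (α/T^α) ∫_0^t (T−u)^{α−1} K_u du + ((T−t)/T)^α K_t`;
for `α > 0` this agrees with `(α/T^α) ∫_0^T (T−u)^{α−1} K_{u∧t} du`. -/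
noncomputable def rl (T α : ℝ) (K : ℝ → ℝ) (t : ℝ) : ℝ :=
  (α / T ^ α) * (∫ u in (0:ℝ)..t, (T - u) ^ (α - 1) * K u) + ((T - t) / T) ^ α * K t

theorem rl_aux_meas (T : ℝ) (K : ℝ → ℝ) (hK : CadlagOn K T) :
    AEStronglyMeasurable K (volume.restrict (Set.Ico 0 T)) := by
  have hm : ∀ n : ℕ, Measurable (fun x : ℝ => K (((⌊((n:ℝ)+1) * x⌋ : ℝ) + 1) / ((n:ℝ)+1))) := by
    intro n
    have h1 : Measurable (fun m : ℤ => K (((m : ℝ) + 1) / ((n:ℝ)+1))) := measurable_from_top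
    exact h1.comp (Int.measurable_floor.comp (measurable_const.mul measurable_id))
  have : AEMeasurable K (volume.restrict (Set.Ico 0 T)) := by
    refine aemeasurable_of_tendsto_metrizable_ae (u := atTop) (fun n => (hm n).aemeasurable) ?_
    refine (ae_restrict_iff' measurableSet_Ico).2 (Eventually.of_forall fun x hx => ?_)
    refine (hK.1 x hx).comp ?_
    refine tendsto_nhdsWithin_iff.2 ⟨?_, Eventually.of_forall fun n => ?_⟩
    · have hl : Tendsto (fun n : ℕ => x + 1 / ((n:ℝ)+1)) atTop (nhds x) := by
        simpa using tendsto_const_nhds.add (tendsto_one_div_add_atTop_nhds_zero_nat (𝕜 := ℝ))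
      refine tendsto_of_tendsto_of_tendsto_of_le_of_le tendsto_const_nhds hl (fun n => ?_)
        (fun n => ?_)
      · have hn : (0:ℝ) < (n:ℝ)+1 := by positivity
        show x ≤ _
        rw [le_div_iff₀ hn]
        have := Int.lt_floor_add_one (((n:ℝ)+1) * x)
        linarith
      · have hn : (0:ℝ) < (n:ℝ)+1 := by positivity
        show _ ≤ x + 1 / ((n:ℝ)+1)
        have e : (x + 1 / ((n:ℝ)+1)) * ((n:ℝ)+1) = ((n:ℝ)+1) * x + 1 := by field_simp
        rw [div_le_iff₀ hn, e]
        have := Int.floor_le (((n:ℝ)+1) * x)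
        linarith
    · have hn : (0:ℝ) < (n:ℝ)+1 := by positivity
      show x ≤ _
      rw [le_div_iff₀ hn]
      have := Int.lt_floor_add_one (((n:ℝ)+1) * x)
      linarith
  exact this.aestronglyMeasurable

theorem rl_aux_int (T : ℝ) (K : ℝ → ℝ) (hK : CadlagOn K T) (s t : ℝ) (hs : 0 ≤ s) (ht : t < T) :
    IntegrableOn K (Set.Icc s t) := by
  have hsub : Set.Icc s t ⊆ Set.Ico 0 T := fun x hx => ⟨hs.trans hx.1, hx.2.trans_lt ht⟩
  have hmeas : AEStronglyMeasurable K (volume.restrict (Set.Icc s t)) :=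
    (rl_aux_meas T K hK).mono_measure (Measure.restrict_mono hsub le_rfl)
  have key : ∀ x ∈ Set.Icc s t, ∃ M, ∀ᶠ y in nhdsWithin x (Set.Icc s t), ‖K y‖ ≤ M := by
    intro x hx
    have hx' := hsub hx
    have hr : ∀ᶠ y in nhdsWithin x (Set.Ici x), ‖K y‖ ≤ ‖K x‖ + 1 :=
      ((hK.1 x hx').norm.eventually_lt_const (lt_add_one _)).mono fun _ h => h.le
    rcases hx'.1.eq_or_lt with h0 | h0
    · refine ⟨‖K x‖ + 1, hr.filter_mono (nhdsWithin_mono _ ?_)⟩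
      intro y hy
      rw [← h0]
      exact hs.trans hy.1
    · obtain ⟨l, hl⟩ := hK.2 x ⟨h0, hx'.2⟩
      have hl' : ∀ᶠ y in nhdsWithin x (Set.Iio x), ‖K y‖ ≤ ‖l‖ + 1 :=
        (hl.norm.eventually_lt_const (lt_add_one _)).mono fun _ h => h.le
      refine ⟨max (‖K x‖ + 1) (‖l‖ + 1), ?_⟩
      refine Filter.Eventually.filter_mono nhdsWithin_le_nhds ?_
      rw [← nhdsLT_sup_nhdsGE, eventually_sup]
      exact ⟨hl'.mono fun _ h => h.trans (le_max_right _ _),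
        hr.mono fun _ h => h.trans (le_max_left _ _)⟩
  suffices h : LocallyIntegrableOn K (Set.Icc s t) volume from
    h.integrableOn_isCompact isCompact_Icc
  intro x hx
  obtain ⟨M, hM⟩ := key x hx
  obtain ⟨u, hu, hu'⟩ := (hM.and self_mem_nhdsWithin).exists_mem
  obtain ⟨v, hv, hxv, hvu⟩ := mem_nhdsWithin.1 hu
  refine ⟨v ∩ Set.Icc s t, Filter.inter_mem (mem_nhdsWithin_of_mem_nhds (hv.mem_nhds hxv)) self_mem_nhdsWithin, ?_⟩
  haveI : IsFiniteMeasure (volume.restrict (v ∩ Set.Icc s t)) :=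
    isFiniteMeasure_restrict.2
      (lt_of_le_of_lt (measure_mono Set.inter_subset_right) measure_Icc_lt_top).ne
  refine Integrable.of_bound (C := M) ?_ ?_
  · exact hmeas.mono_measure (Measure.restrict_mono Set.inter_subset_right le_rfl)
  · exact (ae_restrict_iff' (hv.measurableSet.inter measurableSet_Icc)).2
      (Eventually.of_forall fun y hy => (hu' y (hvu hy)).1)

theorem rl_aux_rpow_cont (T p s t : ℝ) (ht : t < T) :
    ContinuousOn (fun u => (T - u) ^ p) (Set.Icc s t) := by
  refine ContinuousOn.rpow_const (by fun_prop) fun x hx => Or.inl ?_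
  have := hx.2
  have : 0 < T - x := by linarith
  exact this.ne'

theorem rl_aux_deriv (T α u : ℝ) (hu : u < T) :
    HasDerivAt (fun u => (T - u) ^ (-α)) (α * (T - u) ^ (-α - 1)) u := by
  have h := ((hasDerivAt_id u).const_sub T).rpow_const (p := -α)
    (Or.inl (by simp only [id]; linarith))
  refine HasDerivAt.congr_deriv h ?_
  change -1 * -α * (T - u) ^ (-α - 1) = _
  ring

theorem rl_aux_inv (T : ℝ) (hT : 0 < T) (α : ℝ) (hα : 0 < α)
    (K : ℝ → ℝ) (hK : CadlagOn K T) (s t : ℝ) (hs : 0 ≤ s) (hst : s < t) (ht : t < T) :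
    K t - K s = (T / (T - t)) ^ α * (rl T α K t - rl T α K s)
        - α * T ^ α * ∫ u in s..t, (T - u) ^ (-α - 1) * (rl T α K u - rl T α K s) := by
  set k : ℝ → ℝ := fun u => (T - u) ^ (α - 1) * K u with hk
  have hkint : ∀ a b, 0 ≤ a → b < T → IntegrableOn k (Set.Icc a b) := fun a b ha hb =>
    (rl_aux_int T K hK a b ha hb).continuousOn_mul (rl_aux_rpow_cont T _ a b hb) isCompact_Icc
  have hki : ∀ a b, 0 ≤ a → a ≤ b → b < T → IntervalIntegrable k volume a b :=
    fun a b ha hab hb => (intervalIntegrable_iff_integrableOn_Icc_of_le hab).2 (hkint a b ha hb)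
  set G : ℝ → ℝ := fun u => ∫ x in s..u, k x with hG
  have hTα : (0:ℝ) < T ^ α := Real.rpow_pos_of_pos hT α
  set c : ℝ := ((T - s) / T) ^ α * K s with hc
  have hdiff : ∀ u ∈ Set.Icc s t, rl T α K u - rl T α K s
      = (α / T ^ α) * G u + (T - u) ^ α / T ^ α * K u - c := by
    intro u hu
    have hadd : (∫ x in (0:ℝ)..s, k x) + G u = ∫ x in (0:ℝ)..u, k x :=
      intervalIntegral.integral_add_adjacent_intervals
        (hki 0 s le_rfl hs (hst.trans ht)) (hki s u hs hu.1 (hu.2.trans_lt ht))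
    have : 0 < T - u := by have := hu.2; linarith
    rw [← Real.div_rpow this.le hT.le]
    unfold rl
    rw [← hadd]
    ring
  have hGc : ContinuousOn G (Set.Icc s t) := by
    have := intervalIntegral.continuousOn_primitive_interval (μ := volume) (f := k) (a := s) (b := t)
      (by rw [Set.uIcc_of_le hst.le]; exact hkint s t hs ht)
    rwa [Set.uIcc_of_le hst.le] at this
  set P : ℝ → ℝ := fun u => α * ((T - u) ^ (-α) * G u) - T ^ α * c * (T - u) ^ (-α) with hP
  set Q : ℝ → ℝ := fun u => α * T ^ α * ((T - u) ^ (-α - 1) * (rl T α K u - rl T α K s)) with hQ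
  have hPc : ContinuousOn P (Set.Icc s t) :=
    (continuousOn_const.mul ((rl_aux_rpow_cont T _ s t ht).mul hGc)).sub
      (continuousOn_const.mul (rl_aux_rpow_cont T _ s t ht))
  have hQi : IntegrableOn Q (Set.Icc s t) := by
    have h1 : IntegrableOn (fun u => α * T ^ α * ((T - u) ^ (-α - 1) *
        ((α / T ^ α) * G u + (T - u) ^ α / T ^ α * K u - c))) (Set.Icc s t) := by
      refine Integrable.const_mul ?_ _
      refine IntegrableOn.continuousOn_mul (rl_aux_rpow_cont T _ s t ht) ?_ isCompact_Icc
      refine Integrable.sub (Integrable.add ?_ ?_) ?_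
      · exact (hGc.integrableOn_Icc).const_mul _
      · exact (rl_aux_int T K hK s t hs ht).continuousOn_mul
          ((rl_aux_rpow_cont T α s t ht).div_const _) isCompact_Icc
      · exact continuousOn_const.integrableOn_Icc
    refine h1.congr_fun (fun u hu => ?_) measurableSet_Icc
    simp only [hQ]
    rw [hdiff u hu]
  have hder : ∀ u ∈ Set.Ioo s t, HasDerivWithinAt P (Q u) (Set.Ioi u) u := by
    intro u hu
    have huT : u < T := hu.2.trans ht
    have hpos : 0 < T - u := by linarith
    have hGd : HasDerivWithinAt G (k u) (Set.Ici u) u := by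
      have hkr : ContinuousWithinAt k (Set.Ici u) u := by
        refine ContinuousWithinAt.mul ?_ (hK.1 u ⟨hs.trans hu.1.le, huT⟩)
        exact (ContinuousAt.rpow_const (by fun_prop) (Or.inl hpos.ne')).continuousWithinAt
      refine intervalIntegral.integral_hasDerivWithinAt_right
        (hki s u hs hu.1.le huT) (t := Set.Ioi u) ?_ (hkr.mono Set.Ioi_subset_Ici_self)
      refine ⟨Set.Ioo u t, Ioo_mem_nhdsGT hu.2, ?_⟩
      exact ((hkint s t hs ht).mono_set
        (fun x hx => ⟨hu.1.le.trans hx.1.le, hx.2.le⟩)).aestronglyMeasurable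
    have hd := (rl_aux_deriv T α u huT).hasDerivWithinAt (s := Set.Ioi u)
    have := ((hd.mul (hGd.mono Set.Ioi_subset_Ici_self)).const_mul α).sub (hd.const_mul (T ^ α * c))
    refine this.congr_deriv ?_
    simp only [hQ, hk]
    rw [hdiff u ⟨hu.1.le, hu.2.le⟩]
    have e1 : (T - u) ^ (-α) * ((T - u) ^ (α - 1) * K u)
        = (T - u) ^ (-α - 1) * (T - u) ^ α * K u := by
      rw [← mul_assoc, ← Real.rpow_add hpos, ← Real.rpow_add hpos]; congr 2; ring
    rw [e1]
    field_simp
  have hftc : ∫ u in s..t, Q u = P t - P s :=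
    intervalIntegral.integral_eq_sub_of_hasDeriv_right
      (by rwa [Set.uIcc_of_le hst.le])
      (by rw [min_eq_left hst.le, max_eq_right hst.le]; exact hder)
      ((intervalIntegrable_iff_integrableOn_Icc_of_le hst.le).2 hQi)
  have hGs : G s = 0 := by simp [hG]
  have hpt : 0 < T - t := by linarith
  have hps : 0 < T - s := by linarith
  rw [← intervalIntegral.integral_const_mul, hftc, hdiff t ⟨hst.le, le_rfl⟩]
  simp only [hP, hGs, hc]
  rw [Real.div_rpow hT.le hpt.le, Real.div_rpow hps.le hT.le, Real.rpow_neg hpt.le,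
    Real.rpow_neg hps.le]
  have a1 : (T - t) ^ α ≠ 0 := (Real.rpow_pos_of_pos hpt α).ne'
  have a2 : (T - s) ^ α ≠ 0 := (Real.rpow_pos_of_pos hps α).ne'
  field_simp
  ring

theorem rl_aux_bound (T : ℝ) (hT : 0 < T) (α : ℝ) (hα : 0 < α)
    (K : ℝ → ℝ) (hK : CadlagOn K T) (s t : ℝ) (hs : 0 ≤ s) (hst : s < t) (ht : t < T) (C : ℝ)
    (hC : ∀ u ∈ Set.Icc s t, |rl T α K u - rl T α K s| ≤ C) :
    |K t - K s| ≤ 2 * (T / (T - t)) ^ α * C := by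
  have hC0 : 0 ≤ C := (abs_nonneg _).trans (hC s ⟨le_rfl, hst.le⟩)
  have hpt : 0 < T - t := by linarith
  have hps : 0 < T - s := by linarith
  have hTα : (0:ℝ) < T ^ α := Real.rpow_pos_of_pos hT α
  have hA : (0:ℝ) ≤ (T / (T - t)) ^ α := by positivity
  rw [rl_aux_inv T hT α hα K hK s t hs hst ht]
  have hci : IntervalIntegrable (fun u => α * (T - u) ^ (-α - 1)) volume s t := by
    refine ContinuousOn.intervalIntegrable ?_
    rw [Set.uIcc_of_le hst.le]
    exact continuousOn_const.mul (rl_aux_rpow_cont T _ s t ht)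
  have hcval : ∫ u in s..t, α * (T - u) ^ (-α - 1) = (T - t) ^ (-α) - (T - s) ^ (-α) := by
    refine intervalIntegral.integral_eq_sub_of_hasDerivAt (f := fun u => (T - u) ^ (-α)) (fun u hu => ?_) hci
    rw [Set.uIcc_of_le hst.le] at hu
    exact rl_aux_deriv T α u (hu.2.trans_lt ht)
  have hb : |α * ∫ u in s..t, (T - u) ^ (-α - 1) * (rl T α K u - rl T α K s)|
      ≤ C * ((T - t) ^ (-α) - (T - s) ^ (-α)) := by
    rw [← hcval, ← intervalIntegral.integral_const_mul, ← intervalIntegral.integral_const_mul,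
      ← Real.norm_eq_abs]
    refine intervalIntegral.norm_integral_le_of_norm_le hst.le ?_ (hci.const_mul C)
    refine Eventually.of_forall fun u hu => ?_
    have hpu : 0 < T - u := by have := hu.2; linarith
    have h0 : 0 ≤ α * (T - u) ^ (-α - 1) := by positivity
    rw [← mul_assoc, norm_mul, Real.norm_of_nonneg h0, mul_comm]
    exact mul_le_mul_of_nonneg_right (hC u ⟨hu.1.le, hu.2⟩) h0
  have h2 : |α * T ^ α * ∫ u in s..t, (T - u) ^ (-α - 1) * (rl T α K u - rl T α K s)|
      ≤ (T / (T - t)) ^ α * C := by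
    rw [mul_comm α, mul_assoc, abs_mul, abs_of_pos hTα, Real.div_rpow hT.le hpt.le, div_eq_mul_inv,
      ← Real.rpow_neg hpt.le, mul_assoc]
    refine mul_le_mul_of_nonneg_left (hb.trans ?_) hTα.le
    rw [mul_comm]
    refine mul_le_mul_of_nonneg_right ?_ hC0
    have : 0 ≤ (T - s) ^ (-α) := by positivity
    linarith
  have h1 : |(T / (T - t)) ^ α * (rl T α K t - rl T α K s)| ≤ (T / (T - t)) ^ α * C := by
    rw [abs_mul, abs_of_nonneg hA]
    exact mul_le_mul_of_nonneg_left (hC t ⟨hst.le, le_rfl⟩) hA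
  calc _ ≤ _ := abs_sub _ _
    _ ≤ _ := add_le_add h1 h2
    _ = _ := by ring

/-- Inversion formula for the Riemann–Liouville type operator:
`K_t − K_s = (T/(T−t))^α (I_t^α K − I_s^α K) − αT^α ∫_s^t (T−u)^{−α−1}(I_u^α K − I_s^α K) du`
for `0 ≤ s < t < T`; consequently
(1) `|K_t − K_s| ≤ 2 (T/(T−t))^α sup_{u∈[s,t]} |I_u^α K − I_s^α K|`, and
(2) if `I_t^α K` converges as `t ↑ T`, then `(T−t)^α K_t → 0` as `t ↑ T`. -/
theorem rl_inversion (T : ℝ) (hT : 0 < T) (α : ℝ) (hα : 0 < α)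
    (K : ℝ → ℝ) (hK : CadlagOn K T) :
    (∀ s t : ℝ, 0 ≤ s → s < t → t < T →
      K t - K s = (T / (T - t)) ^ α * (rl T α K t - rl T α K s)
        - α * T ^ α * ∫ u in s..t, (T - u) ^ (-α - 1) * (rl T α K u - rl T α K s)) ∧
    (∀ s t : ℝ, 0 ≤ s → s < t → t < T → ∀ C : ℝ,
      (∀ u ∈ Set.Icc s t, |rl T α K u - rl T α K s| ≤ C) →
      |K t - K s| ≤ 2 * (T / (T - t)) ^ α * C) ∧
    (∀ ℓ : ℝ, Filter.Tendsto (fun t => rl T α K t) (nhdsWithin T (Set.Iio T)) (nhds ℓ) →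
      Filter.Tendsto (fun t => (T - t) ^ α * K t) (nhdsWithin T (Set.Iio T)) (nhds 0)) := by
  refine ⟨rl_aux_inv T hT α hα K hK, fun s t hs hst ht C hC =>
    rl_aux_bound T hT α hα K hK s t hs hst ht C hC, fun ℓ hℓ => ?_⟩
  rw [Metric.tendsto_nhds]
  intro ε hε
  have hTα : (0:ℝ) < T ^ α := Real.rpow_pos_of_pos hT α
  set δ : ℝ := ε / (8 * T ^ α) with hδ
  have hδ0 : 0 < δ := by positivity
  obtain ⟨a, haT, ha⟩ := (mem_nhdsLT_iff_exists_Ioo_subset).1 (Metric.tendsto_nhds.1 hℓ δ hδ0)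
  have haT' : a < T := haT
  obtain ⟨s, hs1, hsT⟩ := exists_between (max_lt haT' hT)
  have has : a < s := (le_max_left _ _).trans_lt hs1
  have hs0 : 0 ≤ s := ((le_max_right _ _).trans_lt hs1).le
  have hbd : ∀ u, s ≤ u → u < T → |rl T α K u - rl T α K s| ≤ 2 * δ := by
    intro u hsu huT
    have h1 : dist (rl T α K u) ℓ < δ := ha ⟨has.trans_le hsu, huT⟩
    have h2 : dist (rl T α K s) ℓ < δ := ha ⟨has, hsT⟩
    have := dist_triangle_right (rl T α K u) (rl T α K s) ℓ
    rw [← Real.dist_eq]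
    linarith
  have hz : Tendsto (fun t => (T - t) ^ α * |K s|) (nhdsWithin T (Set.Iio T)) (nhds 0) := by
    have hc : ContinuousAt (fun t => (T - t) ^ α * |K s|) T :=
      (ContinuousAt.rpow_const (by fun_prop) (Or.inr hα.le)).mul continuousAt_const
    have := hc.tendsto
    simp only [sub_self, Real.zero_rpow hα.ne', zero_mul] at this
    exact this.mono_left nhdsWithin_le_nhds
  filter_upwards [hz.eventually_lt_const (half_pos hε), Ioo_mem_nhdsLT hsT] with t h1 h2
  have hpt : 0 < T - t := by have := h2.2; linarith
  have hp : 0 < (T - t) ^ α := Real.rpow_pos_of_pos hpt α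
  have hK1 := rl_aux_bound T hT α hα K hK s t hs0 h2.1 h2.2 (2 * δ)
    (fun u hu => hbd u hu.1 (hu.2.trans_lt h2.2))
  rw [Real.dist_eq, sub_zero, abs_mul, abs_of_pos hp]
  have h3 : |K t| ≤ |K s| + 2 * (T / (T - t)) ^ α * (2 * δ) := by
    have := abs_sub_abs_le_abs_sub (K t) (K s)
    linarith
  have h4 : (T - t) ^ α * (2 * (T / (T - t)) ^ α * (2 * δ)) = ε / 2 := by
    rw [Real.div_rpow hT.le hpt.le, hδ]
    field_simp
    norm_num
  calc _ ≤ (T - t) ^ α * (|K s| + 2 * (T / (T - t)) ^ α * (2 * δ)) :=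
        mul_le_mul_of_nonneg_left h3 hp.le
    _ = (T - t) ^ α * |K s| + ε / 2 := by rw [mul_add, h4]
    _ < ε := by linarith
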